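/- For every integer d there exist a plane graph G and a list assignment L such that: |L(v)| = 3 for every vertex v not incident with the outer face of G; 2 ≤ |L(v)| ≤ 3 for every vertex v incident with the outer face; the vertices with lists of size two form an independent set; the distance between any two distinct cycles of length at most 4 in G is at least d; and G is not L-colorable. (In particular, in Theorem 2 of the paper the hypothesis (T) — that if uvw is a triangle with |L(u)| = 2 and v has a neighbor with list of size two distinct from u, then w has no neighbor with list of size two distinct from u — cannot be omitted, even in the absence of any precolored path.) -/

import Mathlib

open SimpleGraph

/-- A plane embedding (drawing without crossings) of a simple graph `G`:
vertices are mapped to distinct points of the plane, each edge to a simple arc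
joining the images of its endpoints, such that distinct edges meet only in
common endpoints and arcs pass through no other vertex images. -/
structure PlaneEmbedding {V : Type} (G : SimpleGraph V) : Type where
  pos : V → ℝ × ℝ
  pos_inj : Function.Injective pos
  arc : ∀ ⦃u v : V⦄, G.Adj u v → ℝ → ℝ × ℝ
  arc_continuousOn : ∀ ⦃u v : V⦄ (h : G.Adj u v), ContinuousOn (arc h) (Set.Icc 0 1)
  arc_injOn : ∀ ⦃u v : V⦄ (h : G.Adj u v), Set.InjOn (arc h) (Set.Icc 0 1)
  arc_zero : ∀ ⦃u v : V⦄ (h : G.Adj u v), arc h 0 = pos u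
  arc_one : ∀ ⦃u v : V⦄ (h : G.Adj u v), arc h 1 = pos v
  arc_symm : ∀ ⦃u v : V⦄ (h : G.Adj u v),
    arc h.symm '' Set.Icc 0 1 = arc h '' Set.Icc 0 1
  arc_inter : ∀ ⦃u v x y : V⦄ (h₁ : G.Adj u v) (h₂ : G.Adj x y),
    s(u, v) ≠ s(x, y) →
    (arc h₁ '' Set.Icc 0 1) ∩ (arc h₂ '' Set.Icc 0 1) ⊆ pos '' ({u, v} ∩ {x, y})
  arc_vertex : ∀ ⦃u v : V⦄ (h : G.Adj u v) (w : V),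
    pos w ∈ arc h '' Set.Icc 0 1 → w = u ∨ w = v

/-- The point set of the drawing: all vertex images and all edge arcs. -/
def PlaneEmbedding.drawing {V : Type} {G : SimpleGraph V}
    (emb : PlaneEmbedding G) : Set (ℝ × ℝ) :=
  Set.range emb.pos ∪ ⋃ (u : V) (v : V) (h : G.Adj u v), emb.arc h '' Set.Icc 0 1

/-- The outer (unbounded) face of a plane embedding: points not on the drawing
whose connected component in the complement of the drawing is unbounded. -/
def PlaneEmbedding.outerFace {V : Type} {G : SimpleGraph V}
    (emb : PlaneEmbedding G) : Set (ℝ × ℝ) :=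
  {p | p ∉ emb.drawing ∧ ¬ Bornology.IsBounded (connectedComponentIn emb.drawingᶜ p)}

/-- A vertex is incident with the outer face if its image lies on the closure of
the outer face. -/
def PlaneEmbedding.OuterVertex {V : Type} {G : SimpleGraph V}
    (emb : PlaneEmbedding G) (v : V) : Prop :=
  emb.pos v ∈ closure emb.outerFace

/-- `φ` is a proper `L`-coloring of `G`. -/
def IsLColoring {V : Type} (G : SimpleGraph V) (L : V → Finset ℕ) (φ : V → ℕ) : Prop :=
  (∀ v, φ v ∈ L v) ∧ ∀ ⦃u v : V⦄, G.Adj u v → φ u ≠ φ v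

/-- `G` is `L`-colorable. -/
def LColorable {V : Type} (G : SimpleGraph V) (L : V → Finset ℕ) : Prop :=
  ∃ φ, IsLColoring G L φ

/-- `G` is `k`-choosable. -/
def Choosable {V : Type} (G : SimpleGraph V) (k : ℕ) : Prop :=
  ∀ L : V → Finset ℕ, (∀ v, k ≤ (L v).card) → LColorable G L

/-- Any two distinct cycles of length at most `4` in `G` are at distance at least `d`:
for any two such cycles (distinct as subgraphs, i.e. with different edge sets), every
walk from a vertex of one to a vertex of the other has length at least `d`. -/
def CyclesFarApart {V : Type} [DecidableEq V] (G : SimpleGraph V) (d : ℕ) : Prop :=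
  ∀ ⦃a b : V⦄ (c₁ : G.Walk a a) (c₂ : G.Walk b b),
    c₁.IsCycle → c₂.IsCycle → c₁.length ≤ 4 → c₂.length ≤ 4 →
    c₁.edges.toFinset ≠ c₂.edges.toFinset →
    ∀ x ∈ c₁.support, ∀ y ∈ c₂.support, ∀ p : G.Walk x y, d ≤ p.length


namespace PetalGraph

/-- Half of the vertical width of a petal at column `k`; it vanishes at the columns where the
upper and the lower rail meet. -/
def height (n k : ℤ) : ℤ := if k % 4 = 0 ∨ k = 4 * n + 3 then 0 else 1

/-- The point in column `k` of petal `j` on the rail `σ = ±1`. -/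
def pt (n j k σ : ℤ) : ℤ × ℤ := (k, 3 * j * k + σ * height n k)

/-- `p` is one of the points of the three petals. -/
def IsVertex (n : ℤ) (p : ℤ × ℤ) : Prop :=
  ∃ j k σ, (0 ≤ j ∧ j ≤ 2) ∧ (0 ≤ k ∧ k ≤ 4 * n + 3) ∧ (σ = 1 ∨ σ = -1) ∧ p = pt n j k σ

/-- `p` and `q` are consecutive points of a rail. -/
def Rail (n : ℤ) (p q : ℤ × ℤ) : Prop :=
  ∃ j k σ, (0 ≤ j ∧ j ≤ 2) ∧ (0 ≤ k ∧ k < 4 * n + 3) ∧ (σ = 1 ∨ σ = -1) ∧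
    p = pt n j k σ ∧ q = pt n j (k + 1) σ

/-- `p` and `q` are the upper and the lower end of a rung. -/
def Rung (n : ℤ) (p q : ℤ × ℤ) : Prop :=
  ∃ j k, (0 ≤ j ∧ j ≤ 2) ∧ (0 ≤ k ∧ k < 4 * n + 3) ∧ k % 4 = 2 ∧
    p = pt n j k 1 ∧ q = pt n j k (-1)

/-- The vertices of the three petals. -/
abbrev Vertex (n : ℤ) : Type := {p : ℤ × ℤ // IsVertex n p}

lemma height_eq_zero_or_one (n k : ℤ) : height n k = 0 ∨ height n k = 1 := by
  unfold height; split_ifs <;> simp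

lemma pt_fst (n j k σ : ℤ) : (pt n j k σ).1 = k := rfl

lemma pt_eq_pt {n j j' k k' σ σ' : ℤ} (hk : 0 ≤ k) (hσ : σ = 1 ∨ σ = -1)
    (hσ' : σ' = 1 ∨ σ' = -1) (h : pt n j k σ = pt n j' k' σ') :
    k = k' ∧ (k = 0 ∨ (j = j' ∧ (height n k = 0 ∨ σ = σ'))) := by
  have h1 : k = k' := congrArg Prod.fst h
  subst h1
  have h2 : 3 * j * k + σ * height n k = 3 * j' * k + σ' * height n k := congrArg Prod.snd h
  refine ⟨rfl, ?_⟩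
  by_cases hk0 : k = 0
  · exact Or.inl hk0
  right
  have hj : j = j' := by
    have h3 : |3 * (j - j') * k| ≤ 2 := by
      have : 3 * (j - j') * k = σ' * height n k - σ * height n k := by linarith
      rw [this, abs_le]
      rcases hσ with rfl | rfl <;> rcases hσ' with rfl | rfl <;>
        rcases height_eq_zero_or_one n k with h | h <;> rw [h] <;> norm_num
    rw [abs_le] at h3
    by_contra hne
    rcases lt_or_gt_of_ne hne with hlt | hlt <;> nlinarith [show 1 ≤ k by omega]
  subst hj
  refine ⟨rfl, ?_⟩
  rcases height_eq_zero_or_one n k with h | h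
  · exact Or.inl h
  · rw [h] at h2; right; linarith

lemma pt_congr {n j k σ σ' : ℤ} (h : height n k = 0) : pt n j k σ = pt n j k σ' := by
  simp [pt, h]

lemma pt_zero (n j σ : ℤ) : pt n j 0 σ = (0, 0) := by
  simp [pt, height]

lemma Rail.fst {n : ℤ} {p q : ℤ × ℤ} (h : Rail n p q) : q.1 = p.1 + 1 := by
  obtain ⟨j, k, σ, -, -, -, rfl, rfl⟩ := h; rfl

lemma Rung.fst {n : ℤ} {p q : ℤ × ℤ} (h : Rung n p q) : q.1 = p.1 ∧ p.1 % 4 = 2 := by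
  obtain ⟨j, k, -, -, h, rfl, rfl⟩ := h; exact ⟨rfl, h⟩

lemma Rung.ne {n : ℤ} {p q : ℤ × ℤ} (h : Rung n p q) : p ≠ q := by
  obtain ⟨j, k, -, hk, h, rfl, rfl⟩ := h
  intro he
  have := (pt_eq_pt hk.1 (by norm_num) (by norm_num) he).2
  have : height n k = 1 := by unfold height; rw [if_neg]; omega
  omega

/-- Three petals glued at the origin. A petal is a chain of octagons, each split by a rung into
two pentagons, closed by one pentagon and one triangle. -/
def graph (n : ℤ) : SimpleGraph (Vertex n) where
  Adj u v := (Rail n u v ∨ Rung n u v) ∨ (Rail n v u ∨ Rung n v u)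
  symm := ⟨fun _ _ h => h.symm⟩
  loopless := ⟨fun v h => by
    rcases h with (h | h) | (h | h)
    · have := h.fst; omega
    · exact h.ne rfl
    · have := h.fst; omega
    · exact h.ne rfl⟩

/-! ### Short cycles -/

lemma neighbor_of_mod_four_eq_two {n j k σ : ℤ} {v c : Vertex n} (hk : 0 ≤ k) (h2 : k % 4 = 2)
    (hσ : σ = 1 ∨ σ = -1) (hv : v.1 = pt n j k σ) (h : (graph n).Adj v c) :
    c.1 = pt n j k (-σ) ∨ c.1 = pt n j (k + 1) σ ∨ c.1 = pt n j (k - 1) σ := by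
  have h0 : height n k = 1 := by unfold height; rw [if_neg]; omega
  rcases h with (h | h) | (h | h)
  · obtain ⟨j', k', σ', -, hk', hσ', hp, hq⟩ := h
    rw [hv] at hp
    obtain ⟨rfl, h | ⟨rfl, h | rfl⟩⟩ := pt_eq_pt hk hσ hσ' hp
    · omega
    · omega
    · exact Or.inr (Or.inl hq)
  · obtain ⟨j', k', -, hk', -, hp, hq⟩ := h
    rw [hv] at hp
    obtain ⟨rfl, h | ⟨rfl, h | rfl⟩⟩ := pt_eq_pt hk hσ (by norm_num) hp
    · omega
    · omega
    · exact Or.inl hq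
  · obtain ⟨j', k', σ', -, hk', hσ', hq, hp⟩ := h
    rw [hv] at hp
    obtain ⟨rfl, h | ⟨rfl, h | rfl⟩⟩ := pt_eq_pt hk hσ hσ' hp
    · omega
    · omega
    · exact Or.inr (Or.inr (by simpa using hq))
  · obtain ⟨j', k', -, hk', -, hq, hp⟩ := h
    rw [hv] at hp
    obtain ⟨rfl, h | ⟨rfl, h | rfl⟩⟩ := pt_eq_pt hk hσ (by norm_num) hp
    · omega
    · omega
    · exact Or.inl (by simpa using hq)

lemma common_neighbor_of_rung {n : ℤ} {a b c : Vertex n} (hab : Rung n a b)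
    (hac : (graph n).Adj a c) (hbc : (graph n).Adj b c) :
    ∃ j, a.1 = pt n j (4 * n + 2) 1 ∧ b.1 = pt n j (4 * n + 2) (-1) ∧
      c.1 = pt n j (4 * n + 3) 1 := by
  obtain ⟨j, k, -, hk, h2, ha, hb⟩ := hab
  have hca : c.1 ≠ a.1 := fun h => hac.ne (Subtype.ext h.symm)
  have hcb : c.1 ≠ b.1 := fun h => hbc.ne (Subtype.ext h.symm)
  have h1 := neighbor_of_mod_four_eq_two hk.1 h2 (by norm_num) ha hac
  have h3 := neighbor_of_mod_four_eq_two hk.1 h2 (by norm_num) hb hbc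
  rw [← hb] at h1
  rw [neg_neg, ← ha] at h3
  have key : ∀ l l', 0 < l → c.1 = pt n j l 1 → c.1 = pt n j l' (-1) → l = l' ∧
      height n l = 0 := by
    intro l l' hl h h'
    obtain ⟨h5, h6⟩ := pt_eq_pt hl.le (by norm_num) (by norm_num) (h.symm.trans h')
    exact ⟨h5, by omega⟩
  have hl : ∀ l, height n l = 0 → l % 4 = 0 ∨ l = 4 * n + 3 := by
    intro l h; unfold height at h; by_contra h'; rw [if_neg h'] at h; exact one_ne_zero h
  rcases h1 with h1 | h1 | h1
  · exact absurd h1 hcb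
  all_goals
    rcases h3 with h3 | h3 | h3
    · exact absurd h3 hca
    all_goals
      obtain ⟨e1, e2⟩ := key _ _ (by omega) h1 h3
      have := hl _ e2
      first
      | omega
      | (obtain rfl : k = 4 * n + 2 := by omega
         refine ⟨j, ha, hb, ?_⟩
         rw [h1]; ring_nf)

lemma exists_of_triangle {n : ℤ} {a b c : Vertex n} (hab : (graph n).Adj a b)
    (hbc : (graph n).Adj b c) (hca : (graph n).Adj c a) :
    ∃ x y z : Vertex n, ∃ j, x.1 = pt n j (4 * n + 2) 1 ∧ y.1 = pt n j (4 * n + 2) (-1) ∧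
      z.1 = pt n j (4 * n + 3) 1 ∧ ((a = x ∧ b = y ∧ c = z) ∨ (a = y ∧ b = x ∧ c = z) ∨
      (a = x ∧ b = z ∧ c = y) ∨ (a = y ∧ b = z ∧ c = x) ∨ (a = z ∧ b = x ∧ c = y) ∨
      (a = z ∧ b = y ∧ c = x)) := by
  have key : ∀ {x y z : Vertex n}, Rung n x y → (graph n).Adj x z → (graph n).Adj y z →
      ∃ j, x.1 = pt n j (4 * n + 2) 1 ∧ y.1 = pt n j (4 * n + 2) (-1) ∧
      z.1 = pt n j (4 * n + 3) 1 := common_neighbor_of_rung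
  by_cases h1 : Rung n a b
  · obtain ⟨j, hj⟩ := key h1 hca.symm hbc
    exact ⟨a, b, c, j, hj.1, hj.2.1, hj.2.2, by simp⟩
  by_cases h2 : Rung n b a
  · obtain ⟨j, hj⟩ := key h2 hbc hca.symm
    exact ⟨b, a, c, j, hj.1, hj.2.1, hj.2.2, by simp⟩
  by_cases h3 : Rung n b c
  · obtain ⟨j, hj⟩ := key h3 hab.symm hca
    exact ⟨b, c, a, j, hj.1, hj.2.1, hj.2.2, by simp⟩
  by_cases h4 : Rung n c b
  · obtain ⟨j, hj⟩ := key h4 hca hab.symm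
    exact ⟨c, b, a, j, hj.1, hj.2.1, hj.2.2, by simp⟩
  by_cases h5 : Rung n c a
  · obtain ⟨j, hj⟩ := key h5 hbc.symm hab
    exact ⟨c, a, b, j, hj.1, hj.2.1, hj.2.2, by simp⟩
  by_cases h6 : Rung n a c
  · obtain ⟨j, hj⟩ := key h6 hab hbc.symm
    exact ⟨a, c, b, j, hj.1, hj.2.1, hj.2.2, by simp⟩
  exfalso
  rcases hab with (h | h) | (h | h) <;> rcases hbc with (h' | h') | (h' | h') <;>
    rcases hca with (h'' | h'') | (h'' | h'') <;> first | contradiction | skip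
  all_goals
    have := h.fst; have := h'.fst; have := h''.fst; omega

lemma not_rung_of_square {n : ℤ} {a b c d : Vertex n} (hbc : (graph n).Adj b c)
    (hcd : (graph n).Adj c d) (hda : (graph n).Adj d a) (hac : a ≠ c) (hbd : b ≠ d) :
    ¬ Rung n a b := by
  rintro ⟨j, k, -, hk, h2, ha, hb⟩
  have h1 := neighbor_of_mod_four_eq_two hk.1 h2 (by norm_num) ha hda.symm
  have h3 := neighbor_of_mod_four_eq_two hk.1 h2 (by norm_num) hb hbc
  rw [← hb] at h1
  rw [neg_neg, ← ha] at h3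
  have h1' : d.1.1 = k + 1 ∨ d.1.1 = k - 1 := by
    rcases h1 with h | h | h
    · exact absurd (Subtype.ext h.symm) hbd
    · rw [h, pt_fst]; exact Or.inl rfl
    · rw [h, pt_fst]; exact Or.inr rfl
  have h3' : c.1.1 = k + 1 ∨ c.1.1 = k - 1 := by
    rcases h3 with h | h | h
    · exact absurd (Subtype.ext h.symm) hac
    · rw [h, pt_fst]; exact Or.inl rfl
    · rw [h, pt_fst]; exact Or.inr rfl
  rcases hcd with (h | h) | (h | h) <;> have := h.fst <;> omega

lemma no_rail_square {n : ℤ} {a b c d : Vertex n} (hab : Rail n a b) (had : Rail n a d)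
    (hbc : Rail n b c ∨ Rail n c b) (hdc : Rail n d c ∨ Rail n c d) (hac : a ≠ c)
    (hbd : b ≠ d) : False := by
  have hab' := hab.fst
  have had' := had.fst
  obtain ⟨j, k, σ, hj, hk, hσ, ha, hb⟩ := hab
  obtain ⟨j', k', σ', hj', hk', hσ', ha', hd⟩ := had
  obtain ⟨rfl, h⟩ := pt_eq_pt hk.1 hσ hσ' (ha.symm.trans ha')
  have hl : height n k = 0 → k % 4 = 0 := by
    intro h; unfold height at h; by_contra h'; rw [if_neg (by omega)] at h; exact one_ne_zero h
  have hk4 : k % 4 = 0 := by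
    rcases h with h | ⟨rfl, h | rfl⟩
    · omega
    · exact hl h
    · exact absurd (Subtype.ext (hb.trans hd.symm)) hbd
  have h0 : height n k = 0 := by unfold height; rw [if_pos (Or.inl hk4)]
  have h1 : height n (k + 1) = 1 := by unfold height; rw [if_neg]; omega
  have h2 : height n (k + 2) = 1 := by unfold height; rw [if_neg]; omega
  rcases hbc with hbc | hbc
  · rcases hdc with hdc | hdc
    · obtain ⟨j₁, k₁, σ₁, -, hk₁, hσ₁, hb₁, hc₁⟩ := hbc
      obtain ⟨j₂, k₂, σ₂, -, hk₂, hσ₂, hd₂, hc₂⟩ := hdc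
      have e1 : k + 1 = k₁ := by
        have := congrArg Prod.fst (hb.symm.trans hb₁); simpa [pt] using this
      have e2 : k + 1 = k₂ := by
        have := congrArg Prod.fst (hd.symm.trans hd₂); simpa [pt] using this
      subst e1; subst e2
      obtain ⟨-, h | ⟨rfl, h | rfl⟩⟩ :=
        pt_eq_pt (by omega) hσ₁ hσ₂ (hc₁.symm.trans hc₂)
      · omega
      · rw [show k + 1 + 1 = k + 2 by ring] at h; omega
      · exact hbd (Subtype.ext (hb₁.trans hd₂.symm))
    · have := hbc.fst; have := hdc.fst; omega
  · obtain ⟨j₁, k₁, σ₁, -, hk₁, hσ₁, hc₁, hb₁⟩ := hbc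
    obtain ⟨e1, h | ⟨rfl, -⟩⟩ := pt_eq_pt (by omega) hσ hσ₁ (hb.symm.trans hb₁)
    · omega
    · obtain rfl : k = k₁ := by omega
      exact hac (Subtype.ext (by rw [ha, hc₁, pt_congr h0]))

lemma not_square {n : ℤ} {a b c d : Vertex n} (hab : (graph n).Adj a b)
    (hbc : (graph n).Adj b c) (hcd : (graph n).Adj c d) (hda : (graph n).Adj d a)
    (hac : a ≠ c) (hbd : b ≠ d) : False := by
  have rail : ∀ {a b c d : Vertex n}, (graph n).Adj a b → (graph n).Adj b c →
      (graph n).Adj c d → (graph n).Adj d a → a ≠ c → b ≠ d → Rail n a b ∨ Rail n b a := by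
    intro a b c d hab hbc hcd hda hac hbd
    rcases hab with (h | h) | (h | h)
    · exact Or.inl h
    · exact absurd h (not_rung_of_square hbc hcd hda hac hbd)
    · exact Or.inr h
    · exact absurd h (not_rung_of_square hda.symm hcd.symm hbc.symm hbd hac)
  have r1 := rail hab hbc hcd hda hac hbd
  have r2 := rail hbc hcd hda hab hbd hac.symm
  have r3 := rail hcd hda hab hbc hac.symm hbd.symm
  have r4 := rail hda hab hbc hcd hbd.symm hac
  by_cases ha : Rail n a b ∧ Rail n a d
  · exact no_rail_square ha.1 ha.2 r2 r3.symm hac hbd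
  by_cases hb : Rail n b c ∧ Rail n b a
  · exact no_rail_square hb.1 hb.2 r3 r4.symm hbd hac.symm
  by_cases hc : Rail n c d ∧ Rail n c b
  · exact no_rail_square hc.1 hc.2 r4 r1.symm hac.symm hbd.symm
  by_cases hd : Rail n d a ∧ Rail n d c
  · exact no_rail_square hd.1 hd.2 r1 r2.symm hbd.symm hac
  rcases r1 with h1 | h1 <;> rcases r2 with h2 | h2 <;> rcases r3 with h3 | h3 <;>
    rcases r4 with h4 | h4 <;> first | (exfalso; tauto) | skip
  all_goals
    have := h1.fst; have := h2.fst; have := h3.fst; have := h4.fst; omega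

/-- The column of a point of petal `j`, and `0` outside this petal. -/
def petalColumn (j : ℤ) (p : ℤ × ℤ) : ℤ := if |p.2 - 3 * j * p.1| ≤ 1 then p.1 else 0

lemma petalColumn_pt_self {n j k σ : ℤ} (hσ : σ = 1 ∨ σ = -1) :
    petalColumn j (pt n j k σ) = k := by
  unfold petalColumn
  rw [if_pos, pt_fst]
  simp only [pt]
  rcases hσ with rfl | rfl <;> rcases height_eq_zero_or_one n k with h | h <;> simp [h]

lemma petalColumn_pt_of_ne {n j j' k σ : ℤ} (hk : 0 ≤ k) (hj : j ≠ j')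
    (hσ : σ = 1 ∨ σ = -1) : petalColumn j (pt n j' k σ) = 0 := by
  unfold petalColumn
  split_ifs with h
  · rw [abs_le] at h
    simp only [pt] at h ⊢
    by_contra hk0
    have hk1 : 1 ≤ k := by omega
    have hs : -1 ≤ σ * height n k ∧ σ * height n k ≤ 1 := by
      rcases hσ with rfl | rfl <;> rcases height_eq_zero_or_one n k with h | h <;> simp [h]
    rcases lt_or_gt_of_ne hj with hlt | hlt <;> nlinarith
  · rfl

lemma petalColumn_le_of_adj (j : ℤ) {n : ℤ} {u v : Vertex n} (h : (graph n).Adj u v) :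
    petalColumn j u ≤ petalColumn j v + 1 := by
  have rail : ∀ {p q : ℤ × ℤ}, Rail n p q →
      petalColumn j p ≤ petalColumn j q + 1 ∧ petalColumn j q ≤ petalColumn j p + 1 := by
    rintro p q ⟨j', k, σ, -, hk, hσ, rfl, rfl⟩
    by_cases hj : j = j'
    · subst hj; rw [petalColumn_pt_self hσ, petalColumn_pt_self hσ]; omega
    · rw [petalColumn_pt_of_ne hk.1 hj hσ, petalColumn_pt_of_ne (by omega) hj hσ]; omega
  have rung : ∀ {p q : ℤ × ℤ}, Rung n p q → petalColumn j p = petalColumn j q := by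
    rintro p q ⟨j', k, -, hk, -, rfl, rfl⟩
    by_cases hj : j = j'
    · subst hj; rw [petalColumn_pt_self (by norm_num), petalColumn_pt_self (by norm_num)]
    · rw [petalColumn_pt_of_ne hk.1 hj (by norm_num), petalColumn_pt_of_ne hk.1 hj (by norm_num)]
  rcases h with (h | h) | (h | h)
  · exact (rail h).1
  · linarith [rung h]
  · exact (rail h).2
  · linarith [rung h]

lemma petalColumn_le_add_length (j : ℤ) {n : ℤ} {u v : Vertex n} (p : (graph n).Walk u v) :
    petalColumn j u ≤ petalColumn j v + p.length := by
  induction p with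
  | nil => simp
  | cons h p ih =>
    have := petalColumn_le_of_adj j h
    rw [SimpleGraph.Walk.length_cons]; push_cast; linarith

lemma exists_of_short_cycle {n : ℤ} {a : Vertex n} (c : (graph n).Walk a a) (hc : c.IsCycle)
    (h4 : c.length ≤ 4) :
    ∃ x y z : Vertex n, ∃ j, x.1 = pt n j (4 * n + 2) 1 ∧ y.1 = pt n j (4 * n + 2) (-1) ∧
      z.1 = pt n j (4 * n + 3) 1 ∧ (∀ e, e ∈ c.edges ↔ e = s(x, y) ∨ e = s(y, z) ∨ e = s(x, z)) ∧
      ∀ v ∈ c.support, v = x ∨ v = y ∨ v = z := by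
  have h3 := hc.three_le_length
  have hnd := hc.support_nodup
  clear hc
  rcases c with _ | ⟨h₁, c⟩
  · simp at h3
  rcases c with _ | ⟨h₂, c⟩
  · simp at h3
  rcases c with _ | ⟨h₃, c⟩
  · simp at h3
  rcases c with _ | ⟨h₄, c⟩
  · obtain ⟨x, y, z, j, hx, hy, hz, h⟩ := exists_of_triangle h₁ h₂ h₃
    refine ⟨x, y, z, j, hx, hy, hz, ?_, ?_⟩
    · intro e
      simp only [SimpleGraph.Walk.edges_cons, SimpleGraph.Walk.edges_nil, List.mem_cons,
        List.not_mem_nil, or_false]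
      have e1 : s(y, x) = s(x, y) := Sym2.eq_swap
      have e2 : s(z, x) = s(x, z) := Sym2.eq_swap
      have e3 : s(z, y) = s(y, z) := Sym2.eq_swap
      clear hx hy hz h3 h4 hnd
      rcases h with ⟨rfl, rfl, rfl⟩ | ⟨rfl, rfl, rfl⟩ | ⟨rfl, rfl, rfl⟩ | ⟨rfl, rfl, rfl⟩ |
        ⟨rfl, rfl, rfl⟩ | ⟨rfl, rfl, rfl⟩ <;> simp only [e1, e2, e3] <;> tauto
    · intro v hv
      simp only [SimpleGraph.Walk.support_cons, SimpleGraph.Walk.support_nil, List.mem_cons,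
        List.not_mem_nil, or_false] at hv
      clear hx hy hz h3 h4 hnd
      rcases h with ⟨rfl, rfl, rfl⟩ | ⟨rfl, rfl, rfl⟩ | ⟨rfl, rfl, rfl⟩ | ⟨rfl, rfl, rfl⟩ |
        ⟨rfl, rfl, rfl⟩ | ⟨rfl, rfl, rfl⟩ <;> tauto
  rcases c with _ | ⟨h₅, c⟩
  · simp only [SimpleGraph.Walk.support_cons, SimpleGraph.Walk.support_nil, List.tail_cons,
      List.nodup_cons, List.mem_cons, List.not_mem_nil, or_false, not_or] at hnd
    exact (not_square h₁ h₂ h₃ h₄ (Ne.symm hnd.2.1.2) hnd.1.2.1).elim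
  · simp only [SimpleGraph.Walk.length_cons] at h4; omega

lemma cyclesFarApart (d : ℕ) [DecidableEq (Vertex d)] : CyclesFarApart (graph d) d := by
  intro a b c₁ c₂ h₁ h₂ l₁ l₂ hne u hu v hv p
  obtain ⟨x, y, z, j, hx, hy, hz, he, hs⟩ := exists_of_short_cycle c₁ h₁ l₁
  obtain ⟨x', y', z', j', hx', hy', hz', he', hs'⟩ := exists_of_short_cycle c₂ h₂ l₂
  have hj : j ≠ j' := by
    rintro rfl
    obtain rfl : x = x' := Subtype.ext (hx.trans hx'.symm)
    obtain rfl : y = y' := Subtype.ext (hy.trans hy'.symm)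
    obtain rfl : z = z' := Subtype.ext (hz.trans hz'.symm)
    refine hne (Finset.ext fun e => ?_)
    rw [List.mem_toFinset, List.mem_toFinset, he, he']
  have hlen := petalColumn_le_add_length j p
  have hu' : 4 * (d : ℤ) + 2 ≤ petalColumn j u := by
    rcases hs u hu with rfl | rfl | rfl
    · rw [hx, petalColumn_pt_self (by norm_num)]
    · rw [hy, petalColumn_pt_self (by norm_num)]
    · rw [hz, petalColumn_pt_self (by norm_num)]; omega
  have hv' : petalColumn j v = 0 := by
    rcases hs' v hv with rfl | rfl | rfl
    · rw [hx', petalColumn_pt_of_ne (by omega) hj (by norm_num)]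
    · rw [hy', petalColumn_pt_of_ne (by omega) hj (by norm_num)]
    · rw [hz', petalColumn_pt_of_ne (by omega) hj (by norm_num)]
  omega

/-! ### Colorings -/

/-- The list of colors of a point. -/
def lists (p : ℤ × ℤ) : Finset ℕ :=
  if p.1 = 1 then {((p.2 + 1) / 3).toNat, 3}
  else if p.1 % 4 = 1 then {0, 3}
  else if p.1 % 4 = 2 then {1, 2, 3}
  else if p.1 % 4 = 3 then {1, 2}
  else {0, 1, 2}

lemma snd_pt_one {n j σ : ℤ} (hσ : σ = 1 ∨ σ = -1) :
    ((pt n j 1 σ).2 + 1) / 3 = j := by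
  have h : height n 1 = 1 := by unfold height; rw [if_neg]; omega
  simp only [pt, h]
  rcases hσ with rfl | rfl <;> omega

lemma card_lists {n : ℤ} {p : ℤ × ℤ} (hp : IsVertex n p) :
    (lists p).card = if p.1 % 2 = 1 then 2 else 3 := by
  obtain ⟨j, k, σ, hj, hk, hσ, rfl⟩ := hp
  unfold lists
  rw [pt_fst]
  by_cases h1 : k = 1
  · subst h1
    rw [snd_pt_one hσ, if_pos rfl, if_pos (by norm_num), Finset.card_pair (by omega)]
  rw [if_neg h1]
  split_ifs <;> first | omega | rfl

lemma not_lColorable (n : ℕ) : ¬ LColorable (graph n) (fun v => lists v.1) := by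
  classical
  rintro ⟨φ, hL, hφ⟩
  let Φ : ℤ × ℤ → ℕ := fun p => if h : IsVertex n p then φ ⟨p, h⟩ else 0
  have hΦ : ∀ p (h : IsVertex n p), Φ p = φ ⟨p, h⟩ := fun p h => dif_pos h
  have mem : ∀ j k σ, (0 ≤ j ∧ j ≤ 2) → (0 ≤ k ∧ k ≤ 4 * (n : ℤ) + 3) → (σ = 1 ∨ σ = -1) →
      Φ (pt n j k σ) ∈ lists (pt n j k σ) := by
    intro j k σ hj hk hσ
    have hv : IsVertex n (pt n j k σ) := ⟨j, k, σ, hj, hk, hσ, rfl⟩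
    rw [hΦ _ hv]; exact hL ⟨_, hv⟩
  have rail : ∀ j k σ, (0 ≤ j ∧ j ≤ 2) → (0 ≤ k ∧ k < 4 * (n : ℤ) + 3) → (σ = 1 ∨ σ = -1) →
      Φ (pt n j k σ) ≠ Φ (pt n j (k + 1) σ) := by
    intro j k σ hj hk hσ
    have hv : IsVertex n (pt n j k σ) := ⟨j, k, σ, hj, ⟨hk.1, hk.2.le⟩, hσ, rfl⟩
    have hw : IsVertex n (pt n j (k + 1) σ) :=
      ⟨j, k + 1, σ, hj, ⟨by omega, by omega⟩, hσ, rfl⟩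
    rw [hΦ _ hv, hΦ _ hw]
    exact hφ (u := ⟨_, hv⟩) (v := ⟨_, hw⟩) (Or.inl (Or.inl ⟨j, k, σ, hj, hk, hσ, rfl, rfl⟩))
  have rung : ∀ j k, (0 ≤ j ∧ j ≤ 2) → (0 ≤ k ∧ k < 4 * (n : ℤ) + 3) → k % 4 = 2 →
      Φ (pt n j k 1) ≠ Φ (pt n j k (-1)) := by
    intro j k hj hk h2
    have hv : IsVertex n (pt n j k 1) := ⟨j, k, 1, hj, ⟨hk.1, hk.2.le⟩, by norm_num, rfl⟩
    have hw : IsVertex n (pt n j k (-1)) := ⟨j, k, -1, hj, ⟨hk.1, hk.2.le⟩, by norm_num, rfl⟩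
    rw [hΦ _ hv, hΦ _ hw]
    exact hφ (u := ⟨_, hv⟩) (v := ⟨_, hw⟩) (Or.inl (Or.inr ⟨j, k, hj, hk, h2, rfl, rfl⟩))
  obtain ⟨j, hj, hroot⟩ : ∃ j : ℤ, (0 ≤ j ∧ j ≤ 2) ∧ Φ (0, 0) = j.toNat := by
    have h := mem 0 0 1 (by norm_num) (by constructor <;> omega) (by norm_num)
    rw [pt_zero] at h
    have h' : Φ (0, 0) = 0 ∨ Φ (0, 0) = 1 ∨ Φ (0, 0) = 2 := by simpa [lists] using h
    exact ⟨Φ (0, 0), by omega, by omega⟩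
  have split : ∀ i : ℤ, 0 ≤ i → i ≤ n →
      (∀ σ : ℤ, (σ = 1 ∨ σ = -1) → Φ (pt n j (4 * i + 1) σ) = 3) →
      (∀ σ : ℤ, (σ = 1 ∨ σ = -1) →
        Φ (pt n j (4 * i + 3) σ) = 1 ∨ Φ (pt n j (4 * i + 3) σ) = 2) ∧
      Φ (pt n j (4 * i + 3) 1) ≠ Φ (pt n j (4 * i + 3) (-1)) := by
    intro i hi hin h3
    have w : ∀ σ : ℤ, (σ = 1 ∨ σ = -1) →
        Φ (pt n j (4 * i + 2) σ) = 1 ∨ Φ (pt n j (4 * i + 2) σ) = 2 := by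
      intro σ hσ
      have h := mem j (4 * i + 2) σ hj (by omega) hσ
      have h' := rail j (4 * i + 1) σ hj (by omega) hσ
      rw [h3 σ hσ, show 4 * i + 1 + 1 = 4 * i + 2 by ring] at h'
      unfold lists at h
      rw [pt_fst, if_neg (by omega), if_neg (by omega), if_pos (by omega)] at h
      simp only [Finset.mem_insert, Finset.mem_singleton] at h
      omega
    have z : ∀ σ : ℤ, (σ = 1 ∨ σ = -1) →
        Φ (pt n j (4 * i + 3) σ) = 1 ∨ Φ (pt n j (4 * i + 3) σ) = 2 := by
      intro σ hσ
      have h := mem j (4 * i + 3) σ hj (by omega) hσ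
      unfold lists at h
      rw [pt_fst, if_neg (by omega), if_neg (by omega), if_neg (by omega), if_pos (by omega)] at h
      simpa only [Finset.mem_insert, Finset.mem_singleton] using h
    refine ⟨z, ?_⟩
    have e : 4 * i + 2 + 1 = 4 * i + 3 := by ring
    have r1 := rail j (4 * i + 2) 1 hj (by omega) (by norm_num)
    have r2 := rail j (4 * i + 2) (-1) hj (by omega) (by norm_num)
    have r3 := rung j (4 * i + 2) hj (by omega) (by omega)
    rw [e] at r1 r2
    have := w 1 (by norm_num)
    have := w (-1) (by norm_num)
    have := z 1 (by norm_num)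
    have := z (-1) (by norm_num)
    omega
  have three : ∀ i : ℕ, i ≤ n →
      ∀ σ : ℤ, (σ = 1 ∨ σ = -1) → Φ (pt n j (4 * (i : ℤ) + 1) σ) = 3 := by
    intro i
    induction i with
    | zero =>
      intro _ σ hσ
      have h := mem j 1 σ hj (by omega) hσ
      have h' := rail j 0 σ hj (by omega) hσ
      rw [pt_zero, hroot] at h'
      unfold lists at h
      rw [pt_fst, if_pos rfl, snd_pt_one hσ] at h
      simp only [Finset.mem_insert, Finset.mem_singleton] at h
      norm_num at h' ⊢
      omega
    | succ i ih =>
      intro hi σ hσ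
      obtain ⟨z, hz⟩ := split i (by omega) (by omega) (ih (by omega))
      have r : ∀ σ : ℤ, (σ = 1 ∨ σ = -1) →
          Φ (pt n j (4 * (i : ℤ) + 3) σ) ≠ Φ (pt n j (4 * (i : ℤ) + 4) 1) := by
        intro σ hσ
        have h := rail j (4 * i + 3) σ hj (by omega) hσ
        rwa [show 4 * (i : ℤ) + 3 + 1 = 4 * i + 4 by ring,
          pt_congr (k := 4 * (i : ℤ) + 4) (σ' := 1) (by unfold height; rw [if_pos]; omega)] at h
      have h := mem j (4 * i + 4) 1 hj (by omega) (by norm_num)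
      unfold lists at h
      rw [pt_fst, if_neg (by omega), if_neg (by omega), if_neg (by omega),
        if_neg (by omega)] at h
      simp only [Finset.mem_insert, Finset.mem_singleton] at h
      have h0 : Φ (pt n j (4 * (i : ℤ) + 4) 1) = 0 := by
        have := r 1 (by norm_num)
        have := r (-1) (by norm_num)
        have := z 1 (by norm_num)
        have := z (-1) (by norm_num)
        omega
      have h5 := rail j (4 * i + 4) σ hj (by omega) hσ
      rw [pt_congr (σ' := 1) (by unfold height; rw [if_pos]; omega), h0] at h5
      have h6 := mem j (4 * i + 4 + 1) σ hj (by omega) hσ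
      unfold lists at h6
      rw [pt_fst, if_neg (by omega), if_pos (by omega)] at h6
      simp only [Finset.mem_insert, Finset.mem_singleton] at h6
      rw [show 4 * ((i + 1 : ℕ) : ℤ) + 1 = 4 * i + 4 + 1 by push_cast; ring]
      omega
  refine (split n (by omega) le_rfl (three n le_rfl)).2 ?_
  rw [pt_congr (σ' := -1) (if_pos (Or.inr rfl))]

/-! ### The drawing -/

/-- The inclusion of the integer lattice in the plane. -/
def toPlane (p : ℤ × ℤ) : ℝ × ℝ := (p.1, p.2)

lemma toPlane_injective : Function.Injective toPlane := by
  intro p q h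
  have h1 : (p.1 : ℝ) = q.1 := congrArg Prod.fst h
  have h2 : (p.2 : ℝ) = q.2 := congrArg Prod.snd h
  exact Prod.ext (by exact_mod_cast h1) (by exact_mod_cast h2)

lemma not_height_eq_zero_and_succ {n k : ℤ} (hk : k < 4 * n + 3) :
    ¬ (height n k = 0 ∧ height n (k + 1) = 0) := by
  unfold height; split_ifs <;> omega

lemma exists_of_mem_rail {n j k σ : ℤ} {x : ℝ × ℝ}
    (h : x ∈ segment ℝ (toPlane (pt n j k σ)) (toPlane (pt n j (k + 1) σ))) :
    ∃ t : ℝ, 0 ≤ t ∧ t ≤ 1 ∧ x.1 = k + t ∧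
      x.2 = 3 * j * x.1 + σ * ((1 - t) * height n k + t * height n (k + 1)) ∧
      (t = 0 → x = toPlane (pt n j k σ)) ∧ (t = 1 → x = toPlane (pt n j (k + 1) σ)) := by
  rw [segment_eq_image] at h
  obtain ⟨t, ⟨h0, h1⟩, rfl⟩ := h
  refine ⟨t, h0, h1, ?_, ?_, ?_, ?_⟩
  · simp [toPlane, pt]; ring
  · simp [toPlane, pt]; ring
  · rintro rfl; simp
  · rintro rfl; simp

lemma exists_of_mem_rung {n j k : ℤ} (h2 : k % 4 = 2) {x : ℝ × ℝ}
    (h : x ∈ segment ℝ (toPlane (pt n j k 1)) (toPlane (pt n j k (-1)))) :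
    ∃ y : ℝ, -1 ≤ y ∧ y ≤ 1 ∧ x.1 = k ∧ x.2 = 3 * j * x.1 + y ∧
      (y = 1 → x = toPlane (pt n j k 1)) ∧ (y = -1 → x = toPlane (pt n j k (-1))) := by
  have hh : height n k = 1 := by unfold height; rw [if_neg]; omega
  rw [segment_eq_image] at h
  obtain ⟨t, ⟨h0, h1⟩, rfl⟩ := h
  refine ⟨1 - 2 * t, by linarith, by linarith, ?_, ?_, ?_, ?_⟩
  · simp [toPlane, pt]; ring
  · simp [toPlane, pt, hh]; ring
  · intro h
    obtain rfl : t = 0 := by linarith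
    simp
  · intro h
    obtain rfl : t = 1 := by linarith
    simp

/-- The region of the plane that contains the drawing of petal `j`. -/
def petalRegion (n j : ℤ) : Set (ℝ × ℝ) :=
  {x | |x.2 - 3 * j * x.1| ≤ 1 ∧ |x.2 - 3 * j * x.1| ≤ x.1 ∧ x.1 ≤ 4 * n + 3}

lemma fst_eq_zero_of_mem_petalRegion {n j j' : ℤ} {x : ℝ × ℝ} (hj : j ≠ j')
    (h : |x.2 - 3 * j * x.1| ≤ x.1) (h' : x ∈ petalRegion n j') : x.1 = 0 := by
  have h0 : 0 ≤ x.1 := (abs_nonneg _).trans h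
  have h2 := h'.2.1
  rw [abs_le] at h h2
  rcases lt_or_gt_of_ne hj with hlt | hlt
  · have : (j : ℝ) + 1 ≤ j' := by exact_mod_cast hlt
    nlinarith
  · have : (j' : ℝ) + 1 ≤ j := by exact_mod_cast hlt
    nlinarith

lemma sign_cast {σ : ℤ} (hσ : σ = 1 ∨ σ = -1) : (σ : ℝ) = 1 ∨ (σ : ℝ) = -1 := by
  rcases hσ with rfl | rfl <;> simp

lemma rail_subset_petalRegion {n j k σ : ℤ} (hk : 0 ≤ k ∧ k < 4 * n + 3)
    (hσ : σ = 1 ∨ σ = -1) :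
    segment ℝ (toPlane (pt n j k σ)) (toPlane (pt n j (k + 1) σ)) ⊆ petalRegion n j := by
  intro x hx
  obtain ⟨t, h0, h1, hx1, hx2, -, -⟩ := exists_of_mem_rail hx
  have hkn : (k : ℝ) + 1 ≤ 4 * n + 3 := by exact_mod_cast hk.2
  have hk0 : (0 : ℝ) ≤ k := by exact_mod_cast hk.1
  have hx3 : x.2 - 3 * j * x.1 = σ * ((1 - t) * height n k + t * height n (k + 1)) := by
    linarith
  have habs : |x.2 - 3 * j * x.1| = (1 - t) * height n k + t * height n (k + 1) := by
    have : (0 : ℝ) ≤ (1 - t) * height n k + t * height n (k + 1) := by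
      rcases height_eq_zero_or_one n k with h | h <;>
        rcases height_eq_zero_or_one n (k + 1) with h' | h' <;>
        rw [h, h'] <;> push_cast <;> linarith
    rw [hx3]
    rcases sign_cast hσ with h | h <;> rw [h]
    · rw [one_mul, abs_of_nonneg this]
    · rw [neg_one_mul, abs_neg, abs_of_nonneg this]
  refine ⟨?_, ?_, by linarith⟩
  · rw [habs]
    rcases height_eq_zero_or_one n k with h | h <;>
        rcases height_eq_zero_or_one n (k + 1) with h' | h' <;>
        rw [h, h'] <;> push_cast <;> linarith
  · rw [habs, hx1]
    by_cases hk1 : k = 0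
    · have : height n k = 0 := by rw [hk1]; simp [height]
      rcases height_eq_zero_or_one n (k + 1) with h' | h' <;>
        rw [this, h'] <;> push_cast <;> linarith
    · have : (1 : ℝ) ≤ k := by exact_mod_cast (show 1 ≤ k by omega)
      rcases height_eq_zero_or_one n k with h | h <;>
        rcases height_eq_zero_or_one n (k + 1) with h' | h' <;>
        rw [h, h'] <;> push_cast <;> linarith

lemma rung_subset_petalRegion {n j k : ℤ} (hk : 0 ≤ k ∧ k < 4 * n + 3) (h2 : k % 4 = 2) :
    segment ℝ (toPlane (pt n j k 1)) (toPlane (pt n j k (-1))) ⊆ petalRegion n j := by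
  intro x hx
  obtain ⟨y, h0, h1, hx1, hx2, -, -⟩ := exists_of_mem_rung h2 hx
  have hkn : (k : ℝ) + 1 ≤ 4 * n + 3 := by exact_mod_cast hk.2
  have hk0 : (1 : ℝ) ≤ k := by exact_mod_cast (show 1 ≤ k by omega)
  have hx3 : x.2 - 3 * j * x.1 = y := by linarith
  have : |y| ≤ 1 := abs_le.2 ⟨h0, h1⟩
  exact ⟨by rwa [hx3], by rw [hx3]; linarith, by linarith⟩

lemma rail_inter_rail {n : ℤ} {p q p' q' : ℤ × ℤ} (h : Rail n p q) (h' : Rail n p' q')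
    (hne : s(p, q) ≠ s(p', q')) {x : ℝ × ℝ} (hx : x ∈ segment ℝ (toPlane p) (toPlane q))
    (hx' : x ∈ segment ℝ (toPlane p') (toPlane q')) :
    (x = toPlane p ∨ x = toPlane q) ∧ (x = toPlane p' ∨ x = toPlane q') := by
  obtain ⟨j, k, σ, hj, hk, hσ, rfl, rfl⟩ := h
  obtain ⟨j', k', σ', hj', hk', hσ', rfl, rfl⟩ := h'
  have hr := rail_subset_petalRegion hk hσ hx
  have hr' := rail_subset_petalRegion hk' hσ' hx'
  obtain ⟨t, h0, h1, hx1, hx2, e0, e1⟩ := exists_of_mem_rail hx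
  obtain ⟨t', h0', h1', hx1', hx2', e0', e1'⟩ := exists_of_mem_rail hx'
  have hk0 : (0 : ℝ) ≤ k := by exact_mod_cast hk.1
  have hk0' : (0 : ℝ) ≤ k' := by exact_mod_cast hk'.1
  by_cases hjj : j = j'
  · subst hjj
    rcases lt_trichotomy k k' with hlt | rfl | hlt
    · have : (k : ℝ) + 1 ≤ k' := by exact_mod_cast hlt
      exact ⟨Or.inr (e1 (by linarith)), Or.inl (e0' (by linarith))⟩
    · obtain rfl : t = t' := by linarith
      have hσσ : σ' = -σ := by
        have : σ ≠ σ' := by rintro rfl; exact hne rfl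
        omega
      subst hσσ
      have hz : (1 - t) * height n k + t * height n (k + 1) = 0 := by
        push_cast at hx2'
        rcases sign_cast hσ with h | h <;> rw [h] at hx2 hx2' <;> linarith
      have hpos := not_height_eq_zero_and_succ hk.2
      rcases height_eq_zero_or_one n k with h | h <;>
        rcases height_eq_zero_or_one n (k + 1) with h' | h'
      · exact absurd ⟨h, h'⟩ hpos
      · rw [h, h'] at hz
        have : t = 0 := by push_cast at hz; linarith
        exact ⟨Or.inl (e0 this), Or.inl (e0' this)⟩
      · rw [h, h'] at hz
        have : t = 1 := by push_cast at hz; linarith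
        exact ⟨Or.inr (e1 this), Or.inr (e1' this)⟩
      · rw [h, h'] at hz
        push_cast at hz; linarith
    · have : (k' : ℝ) + 1 ≤ k := by exact_mod_cast hlt
      exact ⟨Or.inl (e0 (by linarith)), Or.inr (e1' (by linarith))⟩
  · have hzero := fst_eq_zero_of_mem_petalRegion hjj hr.2.1 hr'
    exact ⟨Or.inl (e0 (by linarith)), Or.inl (e0' (by linarith))⟩

lemma rail_inter_rung {n : ℤ} {p q p' q' : ℤ × ℤ} (h : Rail n p q) (h' : Rung n p' q')
    {x : ℝ × ℝ} (hx : x ∈ segment ℝ (toPlane p) (toPlane q))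
    (hx' : x ∈ segment ℝ (toPlane p') (toPlane q')) :
    (x = toPlane p ∨ x = toPlane q) ∧ (x = toPlane p' ∨ x = toPlane q') := by
  obtain ⟨j, k, σ, hj, hk, hσ, rfl, rfl⟩ := h
  obtain ⟨j', k', hj', hk', h2, rfl, rfl⟩ := h'
  have hr := rail_subset_petalRegion hk hσ hx
  have hr' := rung_subset_petalRegion hk' h2 hx'
  obtain ⟨t, h0, h1, hx1, hx2, e0, e1⟩ := exists_of_mem_rail hx
  obtain ⟨y, h0', h1', hx1', hx2', e0', e1'⟩ := exists_of_mem_rung h2 hx'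
  have hh : height n k' = 1 := by unfold height; rw [if_neg]; omega
  have hk1 : (1 : ℝ) ≤ k' := by exact_mod_cast (show 1 ≤ k' by omega)
  obtain rfl : j = j' := by
    by_contra hjj
    have hzero := fst_eq_zero_of_mem_petalRegion hjj hr.2.1 hr'
    linarith
  have hend : (x = toPlane (pt n j k' 1) ∨ x = toPlane (pt n j k' (-1))) ↔ (y = 1 ∨ y = -1) := by
    constructor
    · rintro (rfl | rfl)
      · left; simp [toPlane, pt, hh] at hx2'; linarith
      · right; simp [toPlane, pt, hh] at hx2'; linarith
    · rintro (h | h)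
      · exact Or.inl (e0' h)
      · exact Or.inr (e1' h)
  rw [hend]
  have hkk : k' = k ∨ k' = k + 1 := by
    have h3 : (k : ℝ) ≤ k' := by linarith
    have h4 : (k' : ℝ) ≤ k + 1 := by linarith
    have h3' : k ≤ k' := by exact_mod_cast h3
    have h4' : k' ≤ k + 1 := by exact_mod_cast h4
    omega
  rcases hkk with rfl | rfl
  · obtain rfl : t = 0 := by linarith
    refine ⟨Or.inl (e0 rfl), ?_⟩
    rw [hh] at hx2
    rcases sign_cast hσ with h | h <;> rw [h] at hx2 <;> push_cast at hx2
    · left; linarith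
    · right; linarith
  · obtain rfl : t = 1 := by push_cast at hx1'; linarith
    refine ⟨Or.inr (e1 rfl), ?_⟩
    rw [hh] at hx2
    rcases sign_cast hσ with h | h <;> rw [h] at hx2 <;> push_cast at hx2
    · left; linarith
    · right; linarith

lemma rung_disjoint_rung {n : ℤ} {p q p' q' : ℤ × ℤ} (h : Rung n p q) (h' : Rung n p' q')
    (hne : s(p, q) ≠ s(p', q')) {x : ℝ × ℝ} (hx : x ∈ segment ℝ (toPlane p) (toPlane q))
    (hx' : x ∈ segment ℝ (toPlane p') (toPlane q')) : False := by
  obtain ⟨j, k, hj, hk, h2, rfl, rfl⟩ := h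
  obtain ⟨j', k', hj', hk', h2', rfl, rfl⟩ := h'
  have hr := rung_subset_petalRegion hk h2 hx
  have hr' := rung_subset_petalRegion hk' h2' hx'
  obtain ⟨y, -, -, hx1, -, -, -⟩ := exists_of_mem_rung h2 hx
  obtain ⟨y', -, -, hx1', -, -, -⟩ := exists_of_mem_rung h2' hx'
  obtain rfl : k = k' := by exact_mod_cast hx1.symm.trans hx1'
  by_cases hjj : j = j'
  · subst hjj; exact hne rfl
  · have hzero := fst_eq_zero_of_mem_petalRegion hjj hr.2.1 hr'
    have : (k : ℝ) = 0 := by linarith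
    have : k = 0 := by exact_mod_cast this
    omega

lemma segment_inter_segment {n : ℤ} {u v u' v' : Vertex n} (h : (graph n).Adj u v)
    (h' : (graph n).Adj u' v') (hne : s(u, v) ≠ s(u', v')) {x : ℝ × ℝ}
    (hx : x ∈ segment ℝ (toPlane u) (toPlane v))
    (hx' : x ∈ segment ℝ (toPlane u') (toPlane v')) :
    (x = toPlane u ∨ x = toPlane v) ∧ (x = toPlane u' ∨ x = toPlane v') := by
  have key : ∀ {p q p' q' : ℤ × ℤ}, Rail n p q ∨ Rung n p q → Rail n p' q' ∨ Rung n p' q' →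
      s(p, q) ≠ s(p', q') → x ∈ segment ℝ (toPlane p) (toPlane q) →
      x ∈ segment ℝ (toPlane p') (toPlane q') →
      (x = toPlane p ∨ x = toPlane q) ∧ (x = toPlane p' ∨ x = toPlane q') := by
    intro p q p' q' h h' hne hx hx'
    rcases h with h | h <;> rcases h' with h' | h'
    · exact rail_inter_rail h h' hne hx hx'
    · exact rail_inter_rung h h' hx hx'
    · exact (rail_inter_rung h' h hx' hx).symm
    · exact (rung_disjoint_rung h h' hne hx hx').elim
  have hne' : s(u.1, v.1) ≠ s(u'.1, v'.1) := by
    intro e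
    refine hne ?_
    simp only [Sym2.eq_iff] at e ⊢
    simpa only [Subtype.ext_iff] using e
  rcases h with h | h <;> rcases h' with h' | h'
  · exact key h h' hne' hx hx'
  · rw [segment_symm] at hx'
    exact (key h h' (by rwa [Sym2.eq_swap (a := v'.1)]) hx hx').imp_right Or.symm
  · rw [segment_symm] at hx
    exact (key h h' (by rwa [Sym2.eq_swap (a := v.1)]) hx hx').imp_left Or.symm
  · rw [segment_symm] at hx hx'
    exact (key h h' (by rwa [Sym2.eq_swap (a := v.1), Sym2.eq_swap (a := v'.1)]) hx hx').imp
      Or.symm Or.symm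

lemma exists_adj {n : ℤ} (w : Vertex n) : ∃ w', (graph n).Adj w w' := by
  obtain ⟨p, j, k, σ, hj, hk, hσ, rfl⟩ := w
  by_cases h : k < 4 * n + 3
  · exact ⟨⟨_, j, k + 1, σ, hj, by omega, hσ, rfl⟩,
      Or.inl (Or.inl ⟨j, k, σ, hj, ⟨hk.1, h⟩, hσ, rfl, rfl⟩)⟩
  · exact ⟨⟨_, j, k - 1, σ, hj, by omega, hσ, rfl⟩,
      Or.inr (Or.inl ⟨j, k - 1, σ, hj, by omega, hσ, rfl, by rw [sub_add_cancel]⟩)⟩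

lemma eq_or_eq_of_mem_segment {n : ℤ} {u v w : Vertex n} (h : (graph n).Adj u v)
    (hw : toPlane w ∈ segment ℝ (toPlane u) (toPlane v)) : w = u ∨ w = v := by
  obtain ⟨w', hw'⟩ := exists_adj w
  by_cases he : s(u, v) = s(w, w')
  · rw [Sym2.eq_iff] at he
    tauto
  · rcases (segment_inter_segment h hw' he hw (left_mem_segment ℝ _ _)).1 with e | e
    · exact Or.inl (Subtype.ext (toPlane_injective e))
    · exact Or.inr (Subtype.ext (toPlane_injective e))

/-- The straight-line drawing of the three petals. -/
noncomputable def embedding (n : ℤ) : PlaneEmbedding (graph n) where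
  pos v := toPlane v
  pos_inj := toPlane_injective.comp Subtype.val_injective
  arc u v _ := AffineMap.lineMap (toPlane u) (toPlane v)
  arc_continuousOn _ _ _ := AffineMap.lineMap_continuous.continuousOn
  arc_injOn _ _ h := (AffineMap.lineMap_injective ℝ
    fun e => h.ne (Subtype.ext (toPlane_injective e))).injOn
  arc_zero _ _ _ := AffineMap.lineMap_apply_zero _ _
  arc_one _ _ _ := AffineMap.lineMap_apply_one _ _
  arc_symm _ _ _ := by
    rw [← segment_eq_image_lineMap, ← segment_eq_image_lineMap, segment_symm]
  arc_inter u v u' v' h h' hne x hx := by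
    rw [← segment_eq_image_lineMap, ← segment_eq_image_lineMap] at hx
    obtain ⟨h1, h2⟩ := segment_inter_segment h h' hne hx.1 hx.2
    have inj : ∀ {a b : Vertex n}, toPlane a = toPlane b → a = b :=
      fun e => Subtype.ext (toPlane_injective e)
    rcases h1 with rfl | rfl
    · exact ⟨u, ⟨by simp, h2.imp inj inj⟩, rfl⟩
    · exact ⟨v, ⟨by simp, h2.imp inj inj⟩, rfl⟩
  arc_vertex _ _ h w hw := by
    rw [← segment_eq_image_lineMap] at hw
    exact eq_or_eq_of_mem_segment h hw

lemma drawing_subset (n : ℤ) :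
    (embedding n).drawing ⊆ ⋃ j, petalRegion n j := by
  have key : ∀ {u v : Vertex n}, (graph n).Adj u v →
      segment ℝ (toPlane u) (toPlane v) ⊆ ⋃ j, petalRegion n j := by
    have link : ∀ {p q : ℤ × ℤ}, Rail n p q ∨ Rung n p q →
        segment ℝ (toPlane p) (toPlane q) ⊆ ⋃ j, petalRegion n j := by
      rintro p q (⟨j, k, σ, hj, hk, hσ, rfl, rfl⟩ | ⟨j, k, hj, hk, h2, rfl, rfl⟩)
      · exact (rail_subset_petalRegion hk hσ).trans (Set.subset_iUnion _ j)
      · exact (rung_subset_petalRegion hk h2).trans (Set.subset_iUnion _ j)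
    rintro u v (h | h)
    · exact link h
    · rw [segment_symm]; exact link h
  rintro x (⟨w, rfl⟩ | hx)
  · obtain ⟨w', hw'⟩ := exists_adj w
    exact key hw' (left_mem_segment ℝ _ _)
  · simp only [Set.mem_iUnion] at hx
    obtain ⟨u, v, h, hx⟩ := hx
    exact key h (by rw [segment_eq_image_lineMap]; exact hx)

lemma outerVertex_of_odd {n : ℤ} {v : Vertex n} (hv : v.1.1 % 2 = 1) :
    (embedding n).OuterVertex v := by
  obtain ⟨p, j, k, σ, hj, hk, hσ, rfl⟩ := v
  rw [pt_fst] at hv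
  have hk1 : (1 : ℝ) ≤ k := by exact_mod_cast (show 1 ≤ k by omega)
  have hh : (height n k : ℝ) = 1 ∨ (height n k : ℝ) = 0 ∧ (k : ℝ) = 4 * n + 3 := by
    unfold height
    split_ifs with h
    · right
      have : k = 4 * n + 3 := by omega
      exact ⟨by simp, by rw [this]; push_cast; ring⟩
    · left; simp
  have hh0 : (0 : ℝ) ≤ height n k ∧ (height n k : ℝ) ≤ 1 := by
    rcases height_eq_zero_or_one n k with h | h <;> rw [h] <;> norm_num
  let r : ℝ → ℝ × ℝ := fun t => (k + t, 3 * j * (k + t) + σ * (height n k + t))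
  have hr : Continuous r := by fun_prop
  have habs : ∀ t, 0 < t → |(r t).2 - 3 * j * (r t).1| = height n k + t := by
    intro t ht
    have : (r t).2 - 3 * j * (r t).1 = σ * (height n k + t) := by simp [r]
    rw [this]
    rcases sign_cast hσ with h | h <;> rw [h]
    · rw [one_mul, abs_of_nonneg (by linarith [hh0.1])]
    · rw [neg_one_mul, abs_neg, abs_of_nonneg (by linarith [hh0.1])]
  have hfst : ∀ t, (r t).1 = k + t := fun t => rfl
  have hsub : r '' Set.Ioi 0 ⊆ (embedding n).drawingᶜ := by
    rintro _ ⟨t, ht : 0 < t, rfl⟩ hx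
    obtain ⟨j', hj'⟩ := Set.mem_iUnion.1 (drawing_subset n hx)
    by_cases hjj : j = j'
    · subst hjj
      have h1 := hj'.1
      have h2 := hj'.2.2
      rw [habs t ht] at h1
      rw [hfst] at h2
      rcases hh with h | ⟨h, h'⟩ <;> linarith
    · have := fst_eq_zero_of_mem_petalRegion hjj
        (by rw [habs t ht, hfst]; linarith [hh0.2]) hj'
      rw [hfst] at this
      linarith
  have hconn : IsPreconnected (r '' Set.Ioi 0) := isPreconnected_Ioi.image r hr.continuousOn
  have houter : ∀ t ∈ Set.Ioi (0 : ℝ), r t ∈ (embedding n).outerFace := by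
    intro t ht
    have hmem := Set.mem_image_of_mem r ht
    refine ⟨hsub hmem, fun hb => ?_⟩
    obtain ⟨C, hC⟩ :=
      (hb.subset (hconn.subset_connectedComponentIn hmem hsub)).exists_norm_le
    have h1 := hC (r (|C| + 1)) ⟨|C| + 1, by simp; positivity, rfl⟩
    have h2 := (norm_fst_le (r (|C| + 1))).trans h1
    rw [hfst, Real.norm_eq_abs] at h2
    linarith [le_abs_self (k + (|C| + 1) : ℝ), le_abs_self C]
  have h0 : r 0 ∈ closure (embedding n).outerFace :=
    map_mem_closure hr (by rw [closure_Ioi]; simp) houter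
  have hr0 : toPlane (pt n j k σ) = r 0 := by simp [toPlane, pt, r]
  rw [← hr0] at h0
  exact h0

lemma finite_vertex (n : ℤ) : Finite (Vertex n) := by
  refine Set.Finite.to_subtype (s := {p | IsVertex n p}) ((Set.finite_Icc
    ((0, -1) : ℤ × ℤ) (4 * n + 3, 6 * (4 * n + 3) + 1)).subset ?_)
  rintro _ ⟨j, k, σ, hj, hk, hσ, rfl⟩
  have h1 : -1 ≤ σ * height n k ∧ σ * height n k ≤ 1 := by
    rcases hσ with rfl | rfl <;> rcases height_eq_zero_or_one n k with h | h <;> simp [h]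
  refine ⟨⟨hk.1, ?_⟩, ⟨hk.2, ?_⟩⟩
  · simp only [pt]; nlinarith
  · simp only [pt]; nlinarith

end PetalGraph

/-- Hypothesis (T) cannot be omitted: for every `d` there is a plane graph `G`
and a list assignment `L` with lists of size `3` on interior vertices, lists of
size `2` or `3` on the outer face, the size-two-list vertices independent, any
two distinct cycles of length at most `4` at distance at least `d`, and yet `G`
is not `L`-colorable. -/
theorem hypothesis_T_necessary (d : ℕ) :
    ∃ (V : Type) (_ : Fintype V) (inst : DecidableEq V) (G : SimpleGraph V)
      (emb : PlaneEmbedding G) (L : V → Finset ℕ),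
      (∀ v, ¬ emb.OuterVertex v → (L v).card = 3) ∧
      (∀ v, emb.OuterVertex v → 2 ≤ (L v).card ∧ (L v).card ≤ 3) ∧
      (∀ u v, (L u).card = 2 → (L v).card = 2 → ¬ G.Adj u v) ∧
      (@CyclesFarApart V inst G d) ∧
      ¬ LColorable G L := by
  classical
  have := PetalGraph.finite_vertex d
  refine ⟨PetalGraph.Vertex d, Fintype.ofFinite _, inferInstance, PetalGraph.graph d,
    PetalGraph.embedding d, fun v => PetalGraph.lists v.1, ?_, ?_, ?_,
    PetalGraph.cyclesFarApart d, PetalGraph.not_lColorable d⟩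
  · intro v hv
    rw [PetalGraph.card_lists v.2, if_neg]
    exact fun h => hv (PetalGraph.outerVertex_of_odd h)
  · intro v _
    rw [PetalGraph.card_lists v.2]
    split_ifs <;> omega
  · intro u v hu hv h
    rw [PetalGraph.card_lists u.2] at hu
    rw [PetalGraph.card_lists v.2] at hv
    have hu' : u.1.1 % 2 = 1 := by by_contra h; simp [h] at hu
    have hv' : v.1.1 % 2 = 1 := by by_contra h; simp [h] at hv
    rcases h with (h | h) | (h | h) <;> have := h.fst <;> omega
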